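/- Every d-dimensional cycle has at least d+2 vertices, and the only d-dimensional cycle on exactly d+2 vertices is Λ_{d+2}^d, the d-dimensional d-complete complex on d+2 vertices; moreover Λ_{d+2}^d is an orientable d-dimensional cycle. -/

import Mathlib

open Finset

namespace ChordedPaper

variable {V : Type*} [DecidableEq V] [Fintype V]

/-- A simplicial complex: a set of finsets (faces) closed under taking subsets.
(The vertices of the complex are the vertices of its faces, so all singletons of
vertices are automatically faces.) -/
def IsComplex (K : Set (Finset V)) : Prop :=
  ∀ F ∈ K, ∀ G ⊆ F, G ∈ K

/-- The vertex set `V(K)` of a complex. -/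
def verts (K : Set (Finset V)) : Set V :=
  {v | ∃ F ∈ K, v ∈ F}

/-- The `d`-dimensional faces (cardinality `d+1`) of `K`. -/
def dfaces (K : Set (Finset V)) (d : ℕ) : Set (Finset V) :=
  {F | F ∈ K ∧ F.card = d + 1}

/-- `K` is pure `d`-dimensional: every face is contained in a `d`-face. -/
def IsPureD (K : Set (Finset V)) (d : ℕ) : Prop :=
  ∀ F ∈ K, ∃ G ∈ dfaces K d, F ⊆ G

/-- The complex generated by a set of facets. -/
def gen (S : Set (Finset V)) : Set (Finset V) :=
  {G | ∃ F ∈ S, G ⊆ F}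

/-- The pure `d`-skeleton `K^{[d]}`: the complex whose facets are the `d`-faces of `K`. -/
def skel (K : Set (Finset V)) (d : ℕ) : Set (Finset V) :=
  gen (dfaces K d)

/-- The induced subcomplex `K_W` on a set `W` of vertices. -/
def induced (K : Set (Finset V)) (W : Set V) : Set (Finset V) :=
  {F | F ∈ K ∧ ↑F ⊆ W}

/-- Two `d`-faces of `S` are adjacent in a `d`-path if they share `d` vertices. -/
def adj (S : Set (Finset V)) (d : ℕ) (F G : Finset V) : Prop :=
  F ∈ S ∧ G ∈ S ∧ (F ∩ G).card = d

/-- `d`-path-connectedness: any two `d`-faces are joined by a `d`-path. -/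
def PathConn (K : Set (Finset V)) (d : ℕ) : Prop :=
  ∀ F ∈ dfaces K d, ∀ G ∈ dfaces K d, Relation.ReflTransGen (adj (dfaces K d) d) F G

/-- A `d`-dimensional cycle: a pure `d`-dimensional, `d`-path-connected complex in which
every `(d-1)`-face lies in an even number of `d`-faces. -/
def IsCycle (Ω : Set (Finset V)) (d : ℕ) : Prop :=
  IsComplex Ω ∧ IsPureD Ω d ∧ (dfaces Ω d).Nonempty ∧ PathConn Ω d ∧
    ∀ f ∈ Ω, Finset.card f = d → Even {F | F ∈ dfaces Ω d ∧ f ⊆ F}.ncard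

/-- A `d`-dimensional cycle in the complex `Γ`. -/
def CycleIn (Γ Ω : Set (Finset V)) (d : ℕ) : Prop :=
  Ω ⊆ Γ ∧ IsCycle Ω d

/-- Face-minimality: no strict subset of the `d`-faces of `Ω` forms a `d`-dimensional cycle. -/
def FaceMinimal (Ω : Set (Finset V)) (d : ℕ) : Prop :=
  ∀ S : Set (Finset V), S ⊂ dfaces Ω d → ¬ IsCycle (gen S) d

/-- Vertex-minimality of a cycle `Ω` in `Γ`: no `d`-dimensional cycle in `Γ` lies on a
strict subset of the vertices of `Ω`. -/
def VertexMinimal (Γ Ω : Set (Finset V)) (d : ℕ) : Prop :=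
  ∀ Ω', CycleIn Γ Ω' d → ¬ (verts Ω' ⊂ verts Ω)

/-- `d`-completeness: every `(d+1)`-subset of the vertex set is a face. -/
def DComplete (K : Set (Finset V)) (d : ℕ) : Prop :=
  ∀ S : Finset V, ↑S ⊆ verts K → S.card = d + 1 → S ∈ K

/-- A chord set `C` of the `d`-dimensional cycle `Ω` in `Γ`. -/
def ChordSet (Γ Ω : Set (Finset V)) (d : ℕ) (C : Set (Finset V)) : Prop :=
  C ⊆ dfaces Γ d ∧ (∀ F ∈ C, F ∉ Ω) ∧ (∀ F ∈ C, ↑F ⊆ verts Ω) ∧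
    ∃ (n : ℕ) (Ωi : Fin n → Set (Finset V)), 2 ≤ n ∧ (∀ i, IsCycle (Ωi i) d) ∧
      (⋃ i, dfaces (Ωi i) d) = dfaces Ω d ∪ C ∧
      (∀ F ∈ C, Even {i | F ∈ dfaces (Ωi i) d}.ncard) ∧
      (∀ F ∈ dfaces Ω d, Odd {i | F ∈ dfaces (Ωi i) d}.ncard) ∧
      (∀ i, (verts (Ωi i)).ncard < (verts Ω).ncard)

/-- `Γ` is `d`-chorded: every face-minimal `d`-dimensional cycle in `Γ` that is not
`d`-complete has a chord set in `Γ`. -/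
def DChorded (Γ : Set (Finset V)) (d : ℕ) : Prop :=
  ∀ Ω, CycleIn Γ Ω d → FaceMinimal Ω d → ¬ DComplete Ω d → ∃ C, ChordSet Γ Ω d C

/-- `Γ` is `d`-cycle-complete: every vertex-minimal `d`-dimensional cycle in `Γ` is
`d`-complete. -/
def DCycleComplete (Γ : Set (Finset V)) (d : ℕ) : Prop :=
  ∀ Ω, CycleIn Γ Ω d → VertexMinimal Γ Ω d → DComplete Ω d

/-- The `d`-closure `Δ_d(K)` of the complex `K`, relative to the vertex set `W`:
it contains the faces of `K`, all subsets of `W` of size at most `d`, and every subset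
`S` of `W` with `|S| > d+1` all of whose `(d+1)`-subsets are faces of `K`. -/
def closure (W : Set V) (K : Set (Finset V)) (d : ℕ) : Set (Finset V) :=
  K ∪ {S | ↑S ⊆ W ∧ S.card ≤ d} ∪
    {S | ↑S ⊆ W ∧ d + 1 < S.card ∧ ∀ T ⊆ S, T.card = d + 1 → T ∈ K}

/-- A `d`-dimensional tree: a pure `d`-dimensional complex with no `d`-dimensional cycles. -/
def IsTree (K : Set (Finset V)) (d : ℕ) : Prop :=
  IsComplex K ∧ IsPureD K d ∧ ∀ Ω, ¬ CycleIn K Ω d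

/-- The unsigned boundary map on chains (appropriate over rings of characteristic 2):
a face is sent to the sum of the faces obtained by deleting one vertex. -/
noncomputable def ubd {R : Type*} [AddCommMonoid R] (c : Finset V →₀ R) : Finset V →₀ R :=
  c.sum fun F a => F.sum fun v => Finsupp.single (F.erase v) a

/-- The signed (oriented) boundary map on chains, the vertices of each face being listed
in increasing order. -/
noncomputable def sbd [LinearOrder V] {R : Type*} [Ring R] (c : Finset V →₀ R) : Finset V →₀ R :=
  c.sum fun F a =>
    F.sum fun v => Finsupp.single (F.erase v) ((-1 : R) ^ (F.filter fun w => w < v).card * a)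

/-- `c` is an `i`-chain on the complex `K`: it is supported on `i`-faces of `K`. -/
def ChainOn {R : Type*} [Zero R] (K : Set (Finset V)) (i : ℕ) (c : Finset V →₀ R) : Prop :=
  ∀ F ∈ c.support, F ∈ K ∧ F.card = i + 1

/-- Vanishing of the reduced simplicial homology `H̃_i(K; R)` for the unsigned boundary
map (this is reduced simplicial homology when `R` has characteristic 2): every `i`-chain
with vanishing boundary (for `i = 0`, the boundary at the empty face is the augmentation ε)
is the boundary of an `(i+1)`-chain. -/
def RedHomZeroU (K : Set (Finset V)) (R : Type*) [AddCommMonoid R] (i : ℕ) : Prop :=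
  ∀ c : Finset V →₀ R, ChainOn K i c → ubd c = 0 →
    ∃ b : Finset V →₀ R, ChainOn K (i + 1) b ∧ ubd b = c

/-- Vanishing of the reduced simplicial homology `H̃_i(K; R)` (oriented chains). -/
def RedHomZeroS [LinearOrder V] (K : Set (Finset V)) (R : Type*) [Ring R] (i : ℕ) : Prop :=
  ∀ c : Finset V →₀ R, ChainOn K i c → sbd c = 0 →
    ∃ b : Finset V →₀ R, ChainOn K (i + 1) b ∧ sbd b = c

/-- Orientability of a `d`-dimensional cycle: there is a choice of signs on its `d`-faces
making the resulting ℤ-chain have zero (oriented) boundary. -/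
def Orientable [LinearOrder V] (Ω : Set (Finset V)) (d : ℕ) : Prop :=
  ∃ c : Finset V →₀ ℤ, ↑c.support = dfaces Ω d ∧
    (∀ F ∈ c.support, c F = 1 ∨ c F = -1) ∧ sbd c = 0

/-- Orientable-vertex-minimality of a cycle `Ω` in `Γ`: no orientable `d`-dimensional
cycle in `Γ` lies on a strict subset of the vertices of `Ω`. -/
def OrientVertexMinimal [LinearOrder V] (Γ Ω : Set (Finset V)) (d : ℕ) : Prop :=
  ∀ Ω', CycleIn Γ Ω' d → Orientable Ω' d → ¬ (verts Ω' ⊂ verts Ω)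

/-- `Γ` is orientably-`d`-cycle-complete: every orientably-vertex-minimal (orientable)
`d`-dimensional cycle in `Γ` is `d`-complete. -/
def OrientDCycleComplete [LinearOrder V] (Γ : Set (Finset V)) (d : ℕ) : Prop :=
  ∀ Ω, CycleIn Γ Ω d → Orientable Ω d → OrientVertexMinimal Γ Ω d → DComplete Ω d

/-- A minimal non-face of `K`: a subset of the vertex set that is not a face, all of whose
proper subsets are faces. -/
def MinNonFace (K : Set (Finset V)) (S : Finset V) : Prop :=
  ↑S ⊆ verts K ∧ S ∉ K ∧ ∀ T ⊂ S, T ∈ K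

lemma aux_exists_other {V : Type*} [DecidableEq V] [Fintype V] {d : ℕ} {Ω : Set (Finset V)}
    (h : IsCycle Ω d) {F : Finset V} (hF : F ∈ dfaces Ω d) {u : V} (hu : u ∈ F) :
    ∃ v, v ∉ F ∧ insert v (F.erase u) ∈ dfaces Ω d := by
  obtain ⟨hc, -, -, -, he⟩ := h
  have hcard : (F.erase u).card = d := by
    rw [Finset.card_erase_of_mem hu, hF.2]; rfl
  have h1 := he (F.erase u) (hc F hF.1 _ (Finset.erase_subset _ _)) hcard
  have hmem : F ∈ {G | G ∈ dfaces Ω d ∧ F.erase u ⊆ G} := ⟨hF, Finset.erase_subset _ _⟩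
  have hpos := (Set.ncard_pos (Set.toFinite _)).2 ⟨F, hmem⟩
  have h2 : 1 < {G | G ∈ dfaces Ω d ∧ F.erase u ⊆ G}.ncard := by
    obtain ⟨k, hk⟩ := h1
    omega
  obtain ⟨G, hG, hne⟩ := Set.exists_ne_of_one_lt_ncard h2 F
  have hlt : (F.erase u).card < G.card := by rw [hcard, hG.1.2]; omega
  obtain ⟨v, hvG, hv⟩ := Finset.exists_mem_notMem_of_card_lt_card hlt
  have hGe : insert v (F.erase u) = G := by
    apply Finset.eq_of_subset_of_card_le
    · exact Finset.insert_subset hvG hG.2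
    · rw [Finset.card_insert_of_notMem hv, hcard, hG.1.2]
  refine ⟨v, ?_, hGe ▸ hG.1⟩
  intro hvF
  have : v = u := by
    by_contra hvu
    exact hv (Finset.mem_erase.2 ⟨hvu, hvF⟩)
  subst this
  rw [Finset.insert_erase hu] at hGe
  exact hne hGe.symm

lemma aux_sub_verts {V : Type*} [DecidableEq V] [Fintype V] {Ω : Set (Finset V)}
    {F : Finset V} (hF : F ∈ Ω) : (F : Set V) ⊆ verts Ω := fun v hv => ⟨F, hF, hv⟩

lemma aux_first {V : Type*} [DecidableEq V] [Fintype V] {d : ℕ} {Ω : Set (Finset V)}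
    (h : IsCycle Ω d) : d + 2 ≤ (verts Ω).ncard := by
  obtain ⟨F, hF⟩ := h.2.2.1
  obtain ⟨u, hu⟩ : F.Nonempty := by
    rw [← Finset.card_pos, hF.2]; omega
  obtain ⟨v, hv, hG⟩ := aux_exists_other h hF hu
  have hs : ((insert v F : Finset V) : Set V) ⊆ verts Ω := by
    rw [Finset.coe_insert]
    exact Set.insert_subset (aux_sub_verts hG.1 (by simp)) (aux_sub_verts hF.1)
  have := Set.ncard_le_ncard hs (Set.toFinite _)
  rw [Set.ncard_coe_finset, Finset.card_insert_of_notMem hv, hF.2] at this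
  omega

lemma aux_subset_erase {V : Type*} [DecidableEq V] {d : ℕ} {S T : Finset V}
    (hS : S.card = d + 2) (hT : T ⊆ S) (hc : T.card ≤ d + 1) : ∃ w ∈ S, T ⊆ S.erase w := by
  obtain ⟨w, hw, hwT⟩ := Finset.exists_mem_notMem_of_card_lt_card
    (show T.card < S.card by omega)
  exact ⟨w, hw, Finset.subset_erase.2 ⟨hT, hwT⟩⟩

lemma aux_eq_erase {V : Type*} [DecidableEq V] {d : ℕ} {S T : Finset V}
    (hS : S.card = d + 2) (hT : T ⊆ S) (hc : T.card = d + 1) : ∃ w ∈ S, T = S.erase w := by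
  obtain ⟨w, hw, h⟩ := aux_subset_erase hS hT hc.le
  refine ⟨w, hw, Finset.eq_of_subset_of_card_le h ?_⟩
  rw [Finset.card_erase_of_mem hw, hS, hc]; rfl

lemma aux_second {V : Type*} [DecidableEq V] [Fintype V] {d : ℕ} {Ω : Set (Finset V)}
    (h : IsCycle Ω d) (hn : (verts Ω).ncard = d + 2) :
    Ω = {F : Finset V | ↑F ⊆ verts Ω ∧ F.card ≤ d + 1} := by
  obtain ⟨S, hS⟩ := (Set.toFinite (verts Ω)).exists_finset_coe
  have hSc : S.card = d + 2 := by rw [← hn, ← hS, Set.ncard_coe_finset]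
  ext T
  constructor
  · intro hT
    refine ⟨aux_sub_verts hT, ?_⟩
    obtain ⟨G, hG, hTG⟩ := h.2.1 T hT
    rw [← hG.2]
    exact Finset.card_le_card hTG
  · rintro ⟨hT, hTc⟩
    rw [← hS, Finset.coe_subset] at hT
    obtain ⟨w, hw, hTw⟩ := aux_subset_erase hSc hT hTc
    refine h.1 _ ?_ _ hTw
    obtain ⟨F, hF⟩ := h.2.2.1
    have hFS : F ⊆ S := by
      rw [← Finset.coe_subset, hS]; exact aux_sub_verts hF.1
    obtain ⟨x, hx, rfl⟩ := aux_eq_erase hSc hFS hF.2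
    by_cases hwx : w = x
    · subst hwx; exact hF.1
    obtain ⟨v, hv, hG⟩ := aux_exists_other h hF (Finset.mem_erase.2 ⟨hwx, hw⟩)
    have hvS : v ∈ S := by
      rw [← Finset.mem_coe, hS]; exact aux_sub_verts hG.1 (by simp)
    have hvx : v = x := by
      by_contra hne
      exact hv (Finset.mem_erase.2 ⟨hne, hvS⟩)
    subst hvx
    have : insert v ((S.erase v).erase w) = S.erase w := by
      rw [Finset.erase_right_comm]
      exact Finset.insert_erase (Finset.mem_erase.2 ⟨Ne.symm hwx, hvS⟩)
    rw [← this]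
    exact hG.1

lemma aux_third {V : Type*} [DecidableEq V] [Fintype V] {d : ℕ} {S : Finset V}
    (hS : S.card = d + 2) : IsCycle {F : Finset V | F ⊆ S ∧ F.card ≤ d + 1} d := by
  have hface : ∀ w ∈ S, S.erase w ∈ dfaces {F : Finset V | F ⊆ S ∧ F.card ≤ d + 1} d := by
    intro w hw
    have : (S.erase w).card = d + 1 := by rw [Finset.card_erase_of_mem hw, hS]; rfl
    exact ⟨⟨Finset.erase_subset _ _, this.le⟩, this⟩
  refine ⟨?_, ?_, ?_, ?_, ?_⟩
  · intro F hF G hG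
    exact ⟨hG.trans hF.1, (Finset.card_le_card hG).trans hF.2⟩
  · intro F hF
    obtain ⟨w, hw, h⟩ := aux_subset_erase hS hF.1 hF.2
    exact ⟨_, hface w hw, h⟩
  · obtain ⟨w, hw⟩ : S.Nonempty := by rw [← Finset.card_pos]; omega
    exact ⟨_, hface w hw⟩
  · intro F hF G hG
    by_cases hFG : F = G
    · subst hFG; exact Relation.ReflTransGen.refl
    refine Relation.ReflTransGen.single ⟨hF, hG, ?_⟩
    obtain ⟨x, hx, rfl⟩ := aux_eq_erase hS hF.1.1 hF.2
    obtain ⟨y, hy, rfl⟩ := aux_eq_erase hS hG.1.1 hG.2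
    have hxy : y ≠ x := by rintro rfl; exact hFG rfl
    have : S.erase x ∩ S.erase y = (S.erase x).erase y := by
      ext z; simp only [Finset.mem_inter, Finset.mem_erase]; tauto
    rw [this, Finset.card_erase_of_mem (Finset.mem_erase.2 ⟨hxy, hy⟩), hF.2]; rfl
  · intro f hf hfc
    have hd : (S \ f).card = 2 := by
      rw [Finset.card_sdiff_of_subset hf.1]; omega
    have hset : {F | F ∈ dfaces {F : Finset V | F ⊆ S ∧ F.card ≤ d + 1} d ∧ f ⊆ F}
        = (((S \ f).image fun w => S.erase w : Finset (Finset V)) : Set (Finset V)) := by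
      ext F
      simp only [Set.mem_setOf_eq, Finset.coe_image, Set.mem_image, Finset.mem_coe,
        Finset.mem_sdiff]
      constructor
      · rintro ⟨hF, hfF⟩
        obtain ⟨x, hx, rfl⟩ := aux_eq_erase hS hF.1.1 hF.2
        exact ⟨x, ⟨hx, fun hxf => Finset.notMem_erase x S (hfF hxf)⟩, rfl⟩
      · rintro ⟨x, ⟨hx, hxf⟩, rfl⟩
        exact ⟨hface x hx, Finset.subset_erase.2 ⟨hf.1, hxf⟩⟩
    rw [hset, Set.ncard_coe_finset, Finset.card_image_of_injOn, hd]
    · exact even_two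
    · intro x hx y hy hxy
      exact Finset.erase_injOn S (Finset.mem_sdiff.1 hx).1 (Finset.mem_sdiff.1 hy).1 hxy

lemma aux_sign {V : Type*} [LinearOrder V] {S : Finset V} {u v : V} (hu : u ∈ S)
    (huv : u < v) :
    (-1 : ℤ) ^ ((S.erase u).filter fun w => w < v).card * (-1) ^ (S.filter fun w => w < u).card
    + (-1 : ℤ) ^ ((S.erase v).filter fun w => w < u).card * (-1) ^ (S.filter fun w => w < v).card
      = 0 := by
  have h1 : ((S.erase u).filter fun w => w < v) = (S.filter fun w => w < v).erase u := by
    ext z; simp only [Finset.mem_filter, Finset.mem_erase]; tauto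
  have h2 : ((S.erase v).filter fun w => w < u) = (S.filter fun w => w < u) := by
    ext z; simp only [Finset.mem_filter, Finset.mem_erase]
    constructor
    · tauto
    · rintro ⟨h, h'⟩
      exact ⟨⟨(h'.trans huv).ne, h⟩, h'⟩
  have hmem : u ∈ S.filter fun w => w < v := Finset.mem_filter.2 ⟨hu, huv⟩
  rw [h1, h2, ← Finset.card_erase_add_one hmem]
  ring

lemma aux_orient {V : Type*} [Fintype V] [LinearOrder V] {d : ℕ} {S : Finset V}
    (hS : S.card = d + 2) : Orientable {F : Finset V | F ⊆ S ∧ F.card ≤ d + 1} d := by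
  set c : Finset V →₀ ℤ :=
    ∑ u ∈ S, Finsupp.single (S.erase u) ((-1 : ℤ) ^ (S.filter fun w => w < u).card) with hc
  have hval : ∀ u ∈ S, c (S.erase u) = (-1 : ℤ) ^ (S.filter fun w => w < u).card := by
    intro u hu
    rw [hc, Finsupp.finset_sum_apply, Finset.sum_eq_single u]
    · simp
    · intro b hb hbu
      rw [Finsupp.single_apply, if_neg]
      intro h
      exact hbu (Finset.erase_injOn S hb hu h)
    · intro h; exact absurd hu h
  have hsupp : ∀ F, c F ≠ 0 → ∃ u ∈ S, F = S.erase u := by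
    intro F hF
    by_contra hcon
    push Not at hcon
    apply hF
    rw [hc, Finsupp.finset_sum_apply]
    refine Finset.sum_eq_zero fun u hu => ?_
    rw [Finsupp.single_apply, if_neg (Ne.symm (hcon u hu))]
  refine ⟨c, ?_, ?_, ?_⟩
  · ext F
    rw [Finset.mem_coe, Finsupp.mem_support_iff]
    constructor
    · intro h
      obtain ⟨w, hw, rfl⟩ := hsupp F h
      have : (S.erase w).card = d + 1 := by rw [Finset.card_erase_of_mem hw, hS]; rfl
      exact ⟨⟨Finset.erase_subset _ _, this.le⟩, this⟩
    · intro hF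
      obtain ⟨x, hx, rfl⟩ := aux_eq_erase hS hF.1.1 hF.2
      rw [hval x hx]
      exact pow_ne_zero _ (by norm_num)
  · intro F hF
    obtain ⟨w, hw, rfl⟩ := hsupp F (Finsupp.mem_support_iff.1 hF)
    rw [hval w hw]
    exact neg_one_pow_eq_or ℤ _
  · have key : sbd c = ∑ u ∈ S, ∑ v ∈ S.erase u, Finsupp.single ((S.erase u).erase v)
        ((-1 : ℤ) ^ ((S.erase u).filter fun w => w < v).card *
          (-1) ^ (S.filter fun w => w < u).card) := by
      unfold sbd
      rw [hc, ← Finsupp.sum_finset_sum_index]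
      · refine Finset.sum_congr rfl fun u hu => ?_
        rw [Finsupp.sum_single_index]
        simp
      · intro F; simp
      · intro F a b
        rw [← Finset.sum_add_distrib]
        refine Finset.sum_congr rfl fun v _ => ?_
        rw [mul_add, Finsupp.single_add]
    rw [key, Finset.sum_sigma']
    refine Finset.sum_involution (fun p _ => ⟨p.2, p.1⟩) ?_ ?_ ?_ ?_
    · rintro ⟨u, v⟩ hp
      simp only [Finset.mem_sigma, Finset.mem_erase] at hp
      obtain ⟨hu, hvu, hv⟩ := hp
      dsimp only
      rw [Finset.erase_right_comm (a := v) (b := u), ← Finsupp.single_add]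
      rcases lt_or_gt_of_ne hvu with h | h
      · rw [add_comm, aux_sign hv h, Finsupp.single_zero]
      · rw [aux_sign hu h, Finsupp.single_zero]
    · rintro ⟨u, v⟩ hp _ heq
      simp only [Finset.mem_sigma, Finset.mem_erase] at hp
      simp only [Sigma.mk.injEq] at heq
      exact hp.2.1 heq.1
    · rintro ⟨u, v⟩ hp
      simp only [Finset.mem_sigma, Finset.mem_erase] at hp ⊢
      exact ⟨hp.2.2, Ne.symm hp.2.1, hp.1⟩
    · rintro ⟨u, v⟩ hp
      rfl

/-- Proposition 3.9: every `d`-dimensional cycle has at least `d+2`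
vertices; the only `d`-dimensional cycle on exactly `d+2` vertices is `Λ_{d+2}^d`, the
`d`-complete complex on `d+2` vertices; and `Λ_{d+2}^d` is an orientable `d`-dimensional
cycle. -/
theorem smallest_cycle_is_complete {V : Type*} [DecidableEq V] [Fintype V]
    [LinearOrder V] (d : ℕ) :
    (∀ Ω : Set (Finset V), IsCycle Ω d → d + 2 ≤ (verts Ω).ncard) ∧
    (∀ Ω : Set (Finset V), IsCycle Ω d → (verts Ω).ncard = d + 2 →
        Ω = {F : Finset V | ↑F ⊆ verts Ω ∧ F.card ≤ d + 1}) ∧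
    (∀ S : Finset V, S.card = d + 2 →
        IsCycle {F : Finset V | F ⊆ S ∧ F.card ≤ d + 1} d ∧
        Orientable {F : Finset V | F ⊆ S ∧ F.card ≤ d + 1} d) := by
  rename_i i1 i2 i3
  refine ⟨fun Ω h => aux_first h, fun Ω h hn => aux_second h hn,
    fun S hS => ⟨aux_third hS, ?_⟩⟩
  have hi : i1 = i3.toDecidableEq := Subsingleton.elim _ _
  subst hi
  exact aux_orient hS

end ChordedPaper
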